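/- Assume α ∈ ℓ^{1,2}(ℤ). Then the series Σ_{j∈ℤ} α_j m_+(0, j) converges absolutely and lim_{λ→0, λ∈ℝ∖{0}} λ·b(λ) = (i/2) Σ_{j∈ℤ} α_j m_+(0, j). In particular, if Σ_{j∈ℤ} α_j m_+(0, j) ≠ 0, then lim_{λ→0, λ∈ℝ∖{0}} 1/(λ b(λ)) = −2i / (Σ_{j∈ℤ} α_j m_+(0, j)) ≠ 0, so that λ ↦ 1/b(λ) extends continuously to λ = 0 with value 0. -/

import Mathlib

open Complex Filter Topology

/-- The summand of the series defining `m_+(λ,x)`, indexed by an increasing tuple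
`j : Fin (n+1) → ℤ` (with the convention `j₀ = x`):
`∏_{l} α_{j_l} (e^{2iλ(j_l − j_{l−1})} − 1)/(2iλ)`. -/
noncomputable def jostTermP (α : ℤ → ℝ) (lam : ℂ) (x : ℝ) {n : ℕ} (j : Fin (n + 1) → ℤ) : ℂ :=
  ∏ l : Fin (n + 1),
    (α (j l) : ℂ) *
      ((Complex.exp (2 * Complex.I * lam *
          ((j l : ℂ) - (Fin.cons (x : ℂ) (fun k : Fin n => ((j k.castSucc : ℤ) : ℂ)) : Fin (n + 1) → ℂ) l)) - 1) /
        (2 * Complex.I * lam))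

/-- The index set for `m_+(λ,x)`: strictly increasing integer tuples above `x`. -/
def jostIdxP (x : ℝ) (n : ℕ) : Type :=
  {j : Fin (n + 1) → ℤ // StrictMono j ∧ x < ((j 0 : ℤ) : ℝ)}

/-- `m_+(λ, x) = 1 + Σ_{n≥1} Σ_{x<j₁<⋯<j_n} ∏_l α_{j_l} (e^{2iλ(j_l−j_{l−1})}−1)/(2iλ)`. -/
noncomputable def mPlus (α : ℤ → ℝ) (lam : ℂ) (x : ℝ) : ℂ :=
  1 + ∑' (n : ℕ) (j : jostIdxP x n), jostTermP α lam x j.1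

/-- The summand of the series defining the zero-energy function `m_+(0,x)`:
`∏_l α_{j_l} (j_l − j_{l−1})` with `j₀ = x`. -/
noncomputable def jostTermP0 (α : ℤ → ℝ) (x : ℝ) {n : ℕ} (j : Fin (n + 1) → ℤ) : ℂ :=
  ∏ l : Fin (n + 1),
    (α (j l) : ℂ) *
      ((j l : ℂ) - (Fin.cons (x : ℂ) (fun k : Fin n => ((j k.castSucc : ℤ) : ℂ)) : Fin (n + 1) → ℂ) l)

/-- `m_+(0, x) = 1 + Σ_{n≥1} Σ_{x<j₁<⋯<j_n} ∏_l α_{j_l} (j_l − j_{l−1})`. -/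
noncomputable def mPlusZero (α : ℤ → ℝ) (x : ℝ) : ℂ :=
  1 + ∑' (n : ℕ) (j : jostIdxP x n), jostTermP0 α x j.1

/-- `b(λ) = 1 − (1/(2iλ)) Σ_{j∈ℤ} α_j m_+(λ, j)` for real `λ ≠ 0`. -/
noncomputable def bCoef (α : ℤ → ℝ) (lam : ℝ) : ℂ :=
  1 - (1 / (2 * Complex.I * (lam : ℂ))) * ∑' j : ℤ, (α j : ℂ) * mPlus α (lam : ℂ) (j : ℝ)

/-- The product of factors `α (j l) * g (j l - j (l - 1))` common to `jostTermP`
and `jostTermP0`. -/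
noncomputable def jostProd (α : ℤ → ℝ) (g : ℂ → ℂ) (x : ℝ) {n : ℕ} (j : Fin (n + 1) → ℤ) : ℂ :=
  ∏ l : Fin (n + 1),
    (α (j l) : ℂ) *
      g ((j l : ℂ) -
        (Fin.cons (x : ℂ) (fun k : Fin n => ((j k.castSucc : ℤ) : ℂ)) : Fin (n + 1) → ℂ) l)

/-- The weight `|α k| (1 + |k|)²`. -/
noncomputable def jostWeight (α : ℤ → ℝ) (k : ℤ) : ℝ := |α k| * (1 + |(k : ℝ)|) ^ 2

lemma jostWeight_nonneg (α : ℤ → ℝ) (k : ℤ) : 0 ≤ jostWeight α k := by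
  unfold jostWeight; positivity

lemma summable_jostWeight {α : ℤ → ℝ} (hα : Summable fun j : ℤ => (j : ℝ) ^ 2 * |α j|) :
    Summable (jostWeight α) := by
  refine Summable.of_norm_bounded_eventually (hα.mul_left 4) ?_
  filter_upwards [(Set.finite_singleton (0 : ℤ)).compl_mem_cofinite] with k hk
  have hk1 : (1 : ℝ) ≤ |(k : ℝ)| := by exact_mod_cast Int.one_le_abs hk
  rw [Real.norm_of_nonneg (jostWeight_nonneg α k), jostWeight, ← sq_abs (k : ℝ)]
  have h : (1 + |(k : ℝ)|) ^ 2 ≤ 4 * |(k : ℝ)| ^ 2 := by nlinarith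
  nlinarith [mul_le_mul_of_nonneg_left h (abs_nonneg (α k))]

lemma norm_jostProd_le (α : ℤ → ℝ) {g : ℂ → ℂ} (hg : ∀ d : ℝ, ‖g d‖ ≤ |d|) (x : ℝ) {n : ℕ}
    (j : Fin (n + 1) → ℤ) :
    ‖jostProd α g x j‖ ≤ (1 + |x|) * ∏ l, jostWeight α (j l) := by
  set p : Fin (n + 1) → ℝ := Fin.cons x (fun k : Fin n => (j k.castSucc : ℝ)) with hp
  have hcast : ∀ l, (Fin.cons (x : ℂ) (fun k : Fin n => ((j k.castSucc : ℤ) : ℂ)) :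
      Fin (n + 1) → ℂ) l = (p l : ℂ) := by
    intro l
    refine Fin.cases ?_ (fun k => ?_) l <;> simp [hp]
  have hprev : ∏ l, (1 + |p l|) ≤ (1 + |x|) * ∏ l, (1 + |(j l : ℝ)|) := by
    rw [Fin.prod_univ_succ, Fin.prod_univ_castSucc (fun l => 1 + |(j l : ℝ)|)]
    simp only [hp, Fin.cons_zero, Fin.cons_succ]
    refine mul_le_mul_of_nonneg_left (le_mul_of_one_le_right ?_ ?_) (by positivity)
    · positivity
    · linarith [abs_nonneg (j (Fin.last n) : ℝ)]
  calc ‖jostProd α g x j‖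
      ≤ ∏ l, (|α (j l)| * (1 + |(j l : ℝ)|)) * (1 + |p l|) := by
        rw [jostProd, norm_prod]
        refine Finset.prod_le_prod (fun _ _ => norm_nonneg _) fun l _ => ?_
        rw [hcast, norm_mul, Complex.norm_real, Real.norm_eq_abs, mul_assoc]
        refine mul_le_mul_of_nonneg_left ?_ (abs_nonneg _)
        have h1 : ((j l : ℂ) - (p l : ℂ)) = (((j l : ℝ) - p l : ℝ) : ℂ) := by push_cast; rfl
        rw [h1]
        nlinarith [hg ((j l : ℝ) - p l), abs_sub (j l : ℝ) (p l), abs_nonneg (j l : ℝ),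
          abs_nonneg (p l), mul_nonneg (abs_nonneg (j l : ℝ)) (abs_nonneg (p l))]
    _ = (∏ l, (|α (j l)| * (1 + |(j l : ℝ)|))) * ∏ l, (1 + |p l|) := Finset.prod_mul_distrib
    _ ≤ (∏ l, (|α (j l)| * (1 + |(j l : ℝ)|))) * ((1 + |x|) * ∏ l, (1 + |(j l : ℝ)|)) :=
        mul_le_mul_of_nonneg_left hprev (by positivity)
    _ = (1 + |x|) * ∏ l, jostWeight α (j l) := by
        rw [mul_left_comm, ← Finset.prod_mul_distrib]
        congr 1
        refine Finset.prod_congr rfl fun l _ => ?_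
        rw [jostWeight]; ring

/-- The set of entries of an increasing tuple. -/
def jostIdxP.toFinset {x : ℝ} (s : Σ n, jostIdxP x n) : Finset ℤ := Finset.univ.image s.2.1

lemma jostIdxP.toFinset_injective (x : ℝ) :
    Function.Injective (jostIdxP.toFinset : (Σ n, jostIdxP x n) → Finset ℤ) := by
  rintro ⟨n, j, hj, hx⟩ ⟨m, k, hk, hy⟩ h
  simp only [jostIdxP.toFinset] at h
  have hc := congrArg Finset.card h
  rw [Finset.card_image_of_injective _ hj.injective,
    Finset.card_image_of_injective _ hk.injective] at hc
  obtain rfl : n = m := by simpa using hc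
  have hr : Set.range j = Set.range k := by
    have := congrArg (fun s : Finset ℤ => (s : Set ℤ)) h
    simpa using this
  obtain rfl : j = k := (hj.range_inj hk).1 hr
  rfl

lemma jostIdxP.prod_toFinset {x : ℝ} (f : ℤ → ℝ) (s : Σ n, jostIdxP x n) :
    ∏ k ∈ jostIdxP.toFinset s, f k = ∏ l, f (s.2.1 l) :=
  Finset.prod_image fun _ _ _ _ h => s.2.2.1.injective h

lemma summable_prod_jostWeight {α : ℤ → ℝ} (hα : Summable fun j : ℤ => (j : ℝ) ^ 2 * |α j|) :
    Summable fun S : Finset ℤ => ∏ k ∈ S, jostWeight α k :=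
  summable_finsetProd_of_summable_nonneg (jostWeight_nonneg α) (summable_jostWeight hα)

lemma summable_prod_jostWeight_idx {α : ℤ → ℝ}
    (hα : Summable fun j : ℤ => (j : ℝ) ^ 2 * |α j|) (x : ℝ) :
    Summable fun s : Σ n, jostIdxP x n => ∏ l, jostWeight α (s.2.1 l) :=
  ((summable_prod_jostWeight hα).comp_injective (jostIdxP.toFinset_injective x)).congr
    (jostIdxP.prod_toFinset _)

lemma tsum_prod_jostWeight_idx_le {α : ℤ → ℝ}
    (hα : Summable fun j : ℤ => (j : ℝ) ^ 2 * |α j|) (x : ℝ) :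
    ∑' s : Σ n, jostIdxP x n, ∏ l, jostWeight α (s.2.1 l) ≤
      ∑' S : Finset ℤ, ∏ k ∈ S, jostWeight α k :=
  (summable_prod_jostWeight_idx hα x).tsum_le_tsum_of_inj jostIdxP.toFinset
    (jostIdxP.toFinset_injective x)
    (fun _ _ => Finset.prod_nonneg fun k _ => jostWeight_nonneg α k)
    (fun s => (jostIdxP.prod_toFinset _ s).ge) (summable_prod_jostWeight hα)

lemma summable_jostProd {α : ℤ → ℝ} (hα : Summable fun j : ℤ => (j : ℝ) ^ 2 * |α j|)
    {g : ℂ → ℂ} (hg : ∀ d : ℝ, ‖g d‖ ≤ |d|) (x : ℝ) :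
    Summable fun s : Σ n, jostIdxP x n => jostProd α g x s.2.1 :=
  Summable.of_norm_bounded ((summable_prod_jostWeight_idx hα x).mul_left (1 + |x|))
    fun s => norm_jostProd_le α hg x s.2.1

/-- The sum over all increasing tuples common to `mPlus` and `mPlusZero`. -/
noncomputable def jostSum (α : ℤ → ℝ) (g : ℂ → ℂ) (x : ℝ) : ℂ :=
  1 + ∑' (n : ℕ) (j : jostIdxP x n), jostProd α g x j.1

lemma jostSum_eq {α : ℤ → ℝ} (hα : Summable fun j : ℤ => (j : ℝ) ^ 2 * |α j|)
    {g : ℂ → ℂ} (hg : ∀ d : ℝ, ‖g d‖ ≤ |d|) (x : ℝ) :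
    jostSum α g x = 1 + ∑' s : Σ n, jostIdxP x n, jostProd α g x s.2.1 := by
  rw [jostSum, (summable_jostProd hα hg x).tsum_sigma]

lemma norm_jostSum_le {α : ℤ → ℝ} (hα : Summable fun j : ℤ => (j : ℝ) ^ 2 * |α j|)
    {g : ℂ → ℂ} (hg : ∀ d : ℝ, ‖g d‖ ≤ |d|) (x : ℝ) :
    ‖jostSum α g x‖ ≤ (1 + ∑' S : Finset ℤ, ∏ k ∈ S, jostWeight α k) * (1 + |x|) ^ 2 := by
  have hb := tsum_of_norm_bounded
    ((summable_prod_jostWeight_idx hα x).mul_left (1 + |x|)).hasSum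
    fun s => norm_jostProd_le α hg x s.2.1
  rw [tsum_mul_left] at hb
  have hle := tsum_prod_jostWeight_idx_le hα x
  have h0 : 0 ≤ ∑' S : Finset ℤ, ∏ k ∈ S, jostWeight α k :=
    tsum_nonneg fun S => Finset.prod_nonneg fun k _ => jostWeight_nonneg α k
  have hx := abs_nonneg x
  rw [jostSum_eq hα hg]
  refine (norm_add_le _ _).trans ?_
  rw [norm_one]
  nlinarith [mul_le_mul_of_nonneg_left hle (by positivity : 0 ≤ 1 + |x|),
    mul_nonneg h0 hx, mul_nonneg h0 (sq_nonneg |x|)]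

lemma norm_mul_jostSum_le {α : ℤ → ℝ} (hα : Summable fun j : ℤ => (j : ℝ) ^ 2 * |α j|)
    {g : ℂ → ℂ} (hg : ∀ d : ℝ, ‖g d‖ ≤ |d|) (k : ℤ) :
    ‖(α k : ℂ) * jostSum α g (k : ℝ)‖ ≤
      (1 + ∑' S : Finset ℤ, ∏ k ∈ S, jostWeight α k) * jostWeight α k := by
  rw [norm_mul, Complex.norm_real, Real.norm_eq_abs, jostWeight, mul_left_comm]
  exact mul_le_mul_of_nonneg_left (norm_jostSum_le hα hg k) (abs_nonneg _)

section Limit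

variable {α : ℤ → ℝ} {ι : Type*} {F : Filter ι} {G : ι → ℂ → ℂ} {g : ℂ → ℂ}

lemma tendsto_jostSum (hα : Summable fun j : ℤ => (j : ℝ) ^ 2 * |α j|)
    (hG : ∀ᶠ i in F, ∀ d : ℝ, ‖G i d‖ ≤ |d|) (hg : ∀ d : ℝ, ‖g d‖ ≤ |d|)
    (hlim : ∀ d, Tendsto (fun i => G i d) F (𝓝 (g d))) (x : ℝ) :
    Tendsto (fun i => jostSum α (G i) x) F (𝓝 (jostSum α g x)) := by
  have h : Tendsto (fun i => 1 + ∑' s : Σ n, jostIdxP x n, jostProd α (G i) x s.2.1) F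
      (𝓝 (jostSum α g x)) := by
    rw [jostSum_eq hα hg]
    refine (tendsto_tsum_of_dominated_convergence
      ((summable_prod_jostWeight_idx hα x).mul_left (1 + |x|)) (fun s => ?_) ?_).const_add 1
    · exact tendsto_finsetProd _ fun l _ => (hlim _).const_mul _
    · filter_upwards [hG] with i hi s using norm_jostProd_le α hi x s.2.1
  refine h.congr' ?_
  filter_upwards [hG] with i hi using (jostSum_eq hα hi x).symm

lemma tendsto_tsum_mul_jostSum (hα : Summable fun j : ℤ => (j : ℝ) ^ 2 * |α j|)
    (hG : ∀ᶠ i in F, ∀ d : ℝ, ‖G i d‖ ≤ |d|) (hg : ∀ d : ℝ, ‖g d‖ ≤ |d|)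
    (hlim : ∀ d, Tendsto (fun i => G i d) F (𝓝 (g d))) :
    Tendsto (fun i => ∑' k : ℤ, (α k : ℂ) * jostSum α (G i) (k : ℝ)) F
      (𝓝 (∑' k : ℤ, (α k : ℂ) * jostSum α g (k : ℝ))) := by
  refine tendsto_tsum_of_dominated_convergence ((summable_jostWeight hα).mul_left
      (1 + ∑' S : Finset ℤ, ∏ k ∈ S, jostWeight α k))
    (fun k => (tendsto_jostSum hα hG hg hlim k).const_mul _) ?_
  filter_upwards [hG] with i hi k using norm_mul_jostSum_le hα hi k

end Limit

/-- The factor `(e^{2iλd} - 1) / (2iλ)`. -/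
noncomputable def jostKernel (lam : ℂ) (d : ℂ) : ℂ :=
  (Complex.exp (2 * Complex.I * lam * d) - 1) / (2 * Complex.I * lam)

lemma norm_jostKernel_le {lam : ℝ} (hl : lam ≠ 0) (d : ℝ) : ‖jostKernel lam d‖ ≤ |d| := by
  have h := Real.norm_exp_I_mul_ofReal_sub_one_le (x := 2 * lam * d)
  have he : Complex.I * ((2 * lam * d : ℝ) : ℂ) = 2 * Complex.I * lam * d := by
    push_cast; ring
  rw [he] at h
  have hpos : 0 < 2 * |lam| := by positivity
  have hn : ‖2 * Complex.I * (lam : ℂ)‖ = 2 * |lam| := by simp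
  rw [jostKernel, norm_div, hn, div_le_iff₀ hpos]
  refine h.trans_eq ?_
  rw [Real.norm_eq_abs, abs_mul, abs_mul, abs_two]
  ring

lemma tendsto_jostKernel (d : ℂ) :
    Tendsto (fun lam : ℝ => jostKernel lam d) (𝓝[≠] 0) (𝓝 d) := by
  have h1 : HasDerivAt (fun z : ℂ => Complex.exp (2 * Complex.I * z * d))
      (2 * Complex.I * d) 0 := by
    have h := ((((hasDerivAt_id (0 : ℂ)).const_mul (2 * Complex.I)).mul_const d)).cexp
    simpa using h
  have h2 := h1.comp_ofReal (z := 0)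
  rw [hasDerivAt_iff_tendsto_slope] at h2
  have h3 := h2.div_const (2 * Complex.I)
  have hI : (2 * Complex.I : ℂ) ≠ 0 := by simp
  rw [mul_div_cancel_left₀ d hI] at h3
  refine h3.congr' ?_
  filter_upwards [self_mem_nhdsWithin] with lam hl
  have hl' : (lam : ℂ) ≠ 0 := by exact_mod_cast hl
  rw [slope_def_module, jostKernel]
  simp only [sub_zero, Complex.real_smul, Complex.ofReal_inv, Complex.ofReal_zero, mul_zero,
    zero_mul, Complex.exp_zero]
  field_simp

lemma mPlus_eq_jostSum (α : ℤ → ℝ) (lam : ℂ) (x : ℝ) :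
    mPlus α lam x = jostSum α (jostKernel lam) x := rfl

lemma mPlusZero_eq_jostSum (α : ℤ → ℝ) (x : ℝ) : mPlusZero α x = jostSum α (fun z => z) x := rfl

/-- For `α ∈ ℓ^{1,2}(ℤ)`, the series `Σ_j α_j m_+(0,j)` converges absolutely and
`λ b(λ) → (i/2) Σ_j α_j m_+(0,j)` as `λ → 0`, `λ ≠ 0`. In particular, if
`Σ_j α_j m_+(0,j) ≠ 0`, then `1/(λ b(λ)) → −2i / Σ_j α_j m_+(0,j) ≠ 0` and
`1/b(λ) → 0` as `λ → 0`, λ ≠ 0. -/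
theorem statement17 (α : ℤ → ℝ) (hα : Summable fun j : ℤ => (j : ℝ) ^ 2 * |α j|) :
    Summable (fun j : ℤ => ‖(α j : ℂ) * mPlusZero α (j : ℝ)‖) ∧
    Tendsto (fun lam : ℝ => (lam : ℂ) * bCoef α lam) (nhdsWithin 0 {0}ᶜ)
      (nhds ((Complex.I / 2) * ∑' j : ℤ, (α j : ℂ) * mPlusZero α (j : ℝ))) ∧
    ((∑' j : ℤ, (α j : ℂ) * mPlusZero α (j : ℝ)) ≠ 0 →
      Tendsto (fun lam : ℝ => 1 / ((lam : ℂ) * bCoef α lam)) (nhdsWithin 0 {0}ᶜ)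
        (nhds (-2 * Complex.I / ∑' j : ℤ, (α j : ℂ) * mPlusZero α (j : ℝ))) ∧
      (-2 * Complex.I / ∑' j : ℤ, (α j : ℂ) * mPlusZero α (j : ℝ)) ≠ 0 ∧
      Tendsto (fun lam : ℝ => 1 / bCoef α lam) (nhdsWithin 0 {0}ᶜ) (nhds 0)) := by
  have hG : ∀ᶠ lam : ℝ in 𝓝[≠] 0, ∀ d : ℝ, ‖jostKernel lam d‖ ≤ |d| := by
    filter_upwards [self_mem_nhdsWithin] with lam hl d using norm_jostKernel_le hl d
  have hid : ∀ d : ℝ, ‖(d : ℂ)‖ ≤ |d| := fun d => by simp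
  have hT : Tendsto (fun lam : ℝ => ∑' j : ℤ, (α j : ℂ) * mPlus α (lam : ℂ) (j : ℝ)) (𝓝[≠] 0)
      (𝓝 (∑' j : ℤ, (α j : ℂ) * mPlusZero α (j : ℝ))) := by
    simp only [mPlus_eq_jostSum, mPlusZero_eq_jostSum]
    exact tendsto_tsum_mul_jostSum hα hG hid tendsto_jostKernel
  have hsum : Summable (fun j : ℤ => ‖(α j : ℂ) * mPlusZero α (j : ℝ)‖) := by
    simp only [mPlusZero_eq_jostSum]
    exact .of_nonneg_of_le (fun _ => norm_nonneg _) (norm_mul_jostSum_le hα hid)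
      ((summable_jostWeight hα).mul_left _)
  set S := ∑' j : ℤ, (α j : ℂ) * mPlusZero α (j : ℝ)
  have h0 : Tendsto (fun lam : ℝ => (lam : ℂ)) (𝓝[≠] 0) (𝓝 0) := by
    simpa using (Complex.continuous_ofReal.tendsto 0).mono_left nhdsWithin_le_nhds
  have hb : Tendsto (fun lam : ℝ => (lam : ℂ) * bCoef α lam) (𝓝[≠] 0)
      (𝓝 (Complex.I / 2 * S)) := by
    have h := h0.add (hT.const_mul (Complex.I / 2))
    rw [zero_add] at h
    refine h.congr' ?_
    filter_upwards [self_mem_nhdsWithin] with lam hl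
    have hl' : (lam : ℂ) ≠ 0 := by exact_mod_cast hl
    rw [bCoef]
    field_simp
    linear_combination (∑' j : ℤ, (α j : ℂ) * mPlus α (lam : ℂ) (j : ℝ)) * Complex.I_sq
  refine ⟨hsum, hb, fun hne => ?_⟩
  have hinv : Tendsto (fun lam : ℝ => 1 / ((lam : ℂ) * bCoef α lam)) (𝓝[≠] 0)
      (𝓝 (-2 * Complex.I / S)) := by
    have h := hb.inv₀ (mul_ne_zero (by simp) hne)
    have he : (Complex.I / 2 * S)⁻¹ = -2 * Complex.I / S := by
      rw [mul_inv, inv_div, Complex.div_I]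
      ring
    rw [he] at h
    simpa only [one_div] using h
  refine ⟨hinv, div_ne_zero (by simp) hne, ?_⟩
  have h := h0.mul hinv
  rw [zero_mul] at h
  refine h.congr' ?_
  filter_upwards [self_mem_nhdsWithin] with lam hl
  have hl' : (lam : ℂ) ≠ 0 := by exact_mod_cast hl
  rw [one_div, mul_inv, mul_inv_cancel_left₀ hl', one_div]
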